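/- arXiv:1504.02628 — 4 statements merged into one kernel-verified Lean document; each statement's English description precedes it below -/
import Mathlib

section
/- Let m1, …, m6 be nonnegative integers with m1 + m2 + ⋯ + m6 = 8. Assume that each of the six sums m1+m5, m3+m4, m2+m6, m4+m6, m4+m5, m5+m6 is at most 3 whenever both of its two terms are positive, and that the support {i ∈ {1,…,6} : m_i > 0} is not contained in any of the collinear index sets {1,4,2}, {2,5,3}, {1,6,3}, nor has fewer than three elements (i.e., the corresponding points among v1,…,v6 are not all on one line). Then m1 + m2 + m3 ≥ 4 and m4 + m5 + m6 ≤ 4. -/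
/-!
Knot multiplicities `m (i-1)` of the points `vᵢ` (1-indexed in the paper, 0-indexed here)
of a C³ quintic simplex spline on the Powell–Sabin 12-split whose support has positive area:
the corner multiplicities sum to at least 4 and the midpoint multiplicities to at most 4.
-/

theorem stmt_5 (m : Fin 6 → ℕ) (hsum : ∑ i, m i = 8)
    -- the C³ smoothness pair conditions
    (h15 : 0 < m 0 → 0 < m 4 → m 0 + m 4 ≤ 3)
    (h34 : 0 < m 2 → 0 < m 3 → m 2 + m 3 ≤ 3)
    (h26 : 0 < m 1 → 0 < m 5 → m 1 + m 5 ≤ 3)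
    (h46 : 0 < m 3 → 0 < m 5 → m 3 + m 5 ≤ 3)
    (h45 : 0 < m 3 → 0 < m 4 → m 3 + m 4 ≤ 3)
    (h56 : 0 < m 4 → 0 < m 5 → m 4 + m 5 ≤ 3)
    -- the support is not contained in a line
    (hcard : 3 ≤ (Finset.univ.filter fun i => 0 < m i).card)
    (hline1 : ¬ (Finset.univ.filter fun i => 0 < m i) ⊆ {0, 3, 1})
    (hline2 : ¬ (Finset.univ.filter fun i => 0 < m i) ⊆ {1, 4, 2})
    (hline3 : ¬ (Finset.univ.filter fun i => 0 < m i) ⊆ {0, 5, 2}) :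
    4 ≤ m 0 + m 1 + m 2 ∧ m 3 + m 4 + m 5 ≤ 4 := by
  have off1 : 0 < m 2 ∨ 0 < m 4 ∨ 0 < m 5 := by
    by_contra! h
    refine hline1 fun i hi => ?_
    fin_cases i <;> simp_all
  have off2 : 0 < m 0 ∨ 0 < m 3 ∨ 0 < m 5 := by
    by_contra! h
    refine hline2 fun i hi => ?_
    fin_cases i <;> simp_all
  have off3 : 0 < m 1 ∨ 0 < m 3 ∨ 0 < m 4 := by
    by_contra! h
    refine hline3 fun i hi => ?_
    fin_cases i <;> simp_all
  simp only [Fin.sum_univ_six] at hsum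
  omega
end

section
/- Let Δ = [v1,v2,v3] ⊂ ℝ² be a nondegenerate triangle, and for x ∈ ℝ² let (β1(x), β2(x), β3(x)) be the barycentric coordinates of x with respect to Δ. Let n ≥ 1, let Q_1, …, Q_n : ℝ² → ℝ be functions, w_1, …, w_n ∈ ℝ weights, and for each i let p*_{i,1}, …, p*_{i,5} ∈ ℝ² be points. Then the Marsden identity (1 + x·y)^5 = Σ_{i=1}^n w_i Q_i(x) Π_{r=1}^5 (1 + p*_{i,r}·y) holds for all x ∈ Δ and all y ∈ ℝ² if and only if the barycentric Marsden identity (β1(x) c1 + β2(x) c2 + β3(x) c3)^5 = Σ_{i=1}^n w_i Q_i(x) Π_{r=1}^5 ( β1(p*_{i,r}) c1 + β2(p*_{i,r}) c2 + β3(p*_{i,r}) c3 ) holds for all x ∈ Δ and all (c1, c2, c3) ∈ ℝ³. -/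
open scoped RealInnerProductSpace

noncomputable section

/-- The plane ℝ². -/
abbrev E2 := EuclideanSpace ℝ (Fin 2)

/-- If every point of the plane is an affine combination of `v1, v2, v3`, then every triple of
values at these points is interpolated by an affine function `v ↦ a + ⟪v, b⟫`. -/
theorem exists_affine_interpolation {v1 v2 v3 : E2} {β1 β2 β3 : E2 → ℝ}
    (hβ : ∀ x : E2, β1 x + β2 x + β3 x = 1 ∧ β1 x • v1 + β2 x • v2 + β3 x • v3 = x)
    (c1 c2 c3 : ℝ) :
    ∃ (a : ℝ) (b : E2), c1 = a + ⟪v1, b⟫ ∧ c2 = a + ⟪v2, b⟫ ∧ c3 = a + ⟪v3, b⟫ := by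
  let T : E2 →ₗ[ℝ] ℝ × ℝ := (innerₗ E2 (v1 - v3)).prod (innerₗ E2 (v2 - v3))
  have hT : Function.Injective T := by
    rw [← LinearMap.ker_eq_bot, LinearMap.ker_eq_bot']
    intro y hy
    obtain ⟨h1, h2⟩ : ⟪v1 - v3, y⟫ = 0 ∧ ⟪v2 - v3, y⟫ = 0 := Prod.mk.inj hy
    rw [inner_sub_left, sub_eq_zero] at h1 h2
    have key (x : E2) : ⟪x, y⟫ = ⟪v3, y⟫ := by
      obtain ⟨hs, hx⟩ := hβ x
      conv_lhs => rw [← hx]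
      simp only [inner_add_left, real_inner_smul_left, h1, h2]
      linear_combination ⟪v3, y⟫ * hs
    rw [← inner_self_eq_zero (𝕜 := ℝ), key y, ← key 0, inner_zero_left]
  have hdim : Module.finrank ℝ E2 = Module.finrank ℝ (ℝ × ℝ) := by simp
  obtain ⟨b, hb⟩ := (LinearMap.injective_iff_surjective_of_finrank_eq_finrank hdim).1 hT
    (c1 - c3, c2 - c3)
  obtain ⟨h1, h2⟩ : ⟪v1 - v3, b⟫ = c1 - c3 ∧ ⟪v2 - v3, b⟫ = c2 - c3 := Prod.mk.inj hb
  rw [inner_sub_left] at h1 h2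
  exact ⟨c3 - ⟪v3, b⟫, b, by linarith, by linarith, by ring⟩

/-- Equivalence of the Marsden identity and the barycentric Marsden identity. -/
theorem stmt_7 (v1 v2 v3 : E2) (hΔ : AffineIndependent ℝ ![v1, v2, v3])
    (β1 β2 β3 : E2 → ℝ)
    (hβ : ∀ x : E2, β1 x + β2 x + β3 x = 1 ∧ β1 x • v1 + β2 x • v2 + β3 x • v3 = x)
    (n : ℕ) (hn : 1 ≤ n) (Q : Fin n → E2 → ℝ) (w : Fin n → ℝ) (p : Fin n → Fin 5 → E2) :
    (∀ x ∈ convexHull ℝ ({v1, v2, v3} : Set E2), ∀ y : E2,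
        (1 + ⟪x, y⟫) ^ 5 = ∑ i, w i * Q i x * ∏ r, (1 + ⟪p i r, y⟫))
    ↔ (∀ x ∈ convexHull ℝ ({v1, v2, v3} : Set E2), ∀ c1 c2 c3 : ℝ,
        (β1 x * c1 + β2 x * c2 + β3 x * c3) ^ 5 =
          ∑ i, w i * Q i x *
            ∏ r, (β1 (p i r) * c1 + β2 (p i r) * c2 + β3 (p i r) * c3)) := by
  have affine (a : ℝ) (b x : E2) :
      β1 x * (a + ⟪v1, b⟫) + β2 x * (a + ⟪v2, b⟫) + β3 x * (a + ⟪v3, b⟫) = a + ⟪x, b⟫ := by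
    obtain ⟨hs, hx⟩ := hβ x
    conv_rhs => rw [← hx]
    simp only [inner_add_left, real_inner_smul_left]
    linear_combination a * hs
  constructor
  · intro H x hx c1 c2 c3
    obtain ⟨a, b, rfl, rfl, rfl⟩ := exists_affine_interpolation hβ c1 c2 c3
    simp only [affine]
    have of_ne_zero (s : ℝ) (hs : s ≠ 0) :
        (s + ⟪x, b⟫) ^ 5 = ∑ i, w i * Q i x * ∏ r, (s + ⟪p i r, b⟫) := by
      have scale (z : E2) : s + ⟪z, b⟫ = s * (1 + ⟪z, s⁻¹ • b⟫) := by
        rw [real_inner_smul_right]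
        field_simp
      simp only [scale, mul_pow, H x hx, Finset.prod_mul_distrib, Finset.prod_const,
        Finset.card_univ, Fintype.card_fin, Finset.mul_sum]
      exact Finset.sum_congr rfl fun i _ => by ring
    have heq : (fun s : ℝ => (s + ⟪x, b⟫) ^ 5) =
        fun s => ∑ i, w i * Q i x * ∏ r, (s + ⟪p i r, b⟫) :=
      Continuous.ext_on (dense_compl_singleton (0 : ℝ)) (by fun_prop) (by fun_prop) of_ne_zero
    exact congrFun heq a
  · intro H x hx y
    simpa only [affine] using H x hx (1 + ⟪v1, y⟫) (1 + ⟪v2, y⟫) (1 + ⟪v3, y⟫)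
end
end

section
/- Let Δ ⊂ ℝ² be a nondegenerate (closed) triangle whose longest edge has length h, let n ≥ 1, and let S_1, …, S_n : Δ → ℝ and points ξ_1, …, ξ_n ∈ Δ satisfy: Σ_{i=1}^n S_i(x) = 1 and Σ_{i=1}^n ξ_i S_i(x) = x for all x ∈ Δ; and the stability estimate ‖b‖_∞ ≤ K · sup_{x∈Δ} |Σ_{i=1}^n b_i S_i(x)| for every b ∈ ℝ^n, for some constant K > 0. Let f be twice continuously differentiable on an open set containing Δ, with Hessian matrix H, and suppose f(x) = Σ_{i=1}^n c_i S_i(x) for all x ∈ Δ. Then max_{1≤i≤n} |c_i − f(ξ_i)| ≤ 2 K h² max_{x∈Δ} ‖H(x)‖_∞. -/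
noncomputable section

/-- The entry `(i,j)` of the Hessian matrix of `f` at `x`, with respect to the standard
basis of ℝ². -/
def hessianEntry (f : E2 → ℝ) (x : E2) (i j : Fin 2) : ℝ :=
  iteratedFDeriv ℝ 2 f x ![EuclideanSpace.single i (1 : ℝ), EuclideanSpace.single j (1 : ℝ)]

/-- The matrix infinity norm (maximum absolute row sum) of the 2×2 Hessian of `f` at `x`. -/
def hessianInftyNorm (f : E2 → ℝ) (x : E2) : ℝ :=
  max (|hessianEntry f x 0 0| + |hessianEntry f x 0 1|)
    (|hessianEntry f x 1 0| + |hessianEntry f x 1 1|)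

/-- A quadratic form estimate: the Hessian form is controlled by its matrix infinity norm. -/
lemma abs_fderiv_fderiv_apply_le (f : E2 → ℝ) (x v : E2) :
    |fderiv ℝ (fderiv ℝ f) x v v| ≤ 2 * ‖v‖ ^ 2 * hessianInftyNorm f x := by
  set B := fderiv ℝ (fderiv ℝ f) x with hB
  have entry (i j : Fin 2) : hessianEntry f x i j =
      B (EuclideanSpace.single i 1) (EuclideanSpace.single j 1) := by
    simp [hessianEntry, iteratedFDeriv_two_apply, hB]
  have hv : v = v 0 • EuclideanSpace.single 0 (1 : ℝ) + v 1 • EuclideanSpace.single 1 (1 : ℝ) := by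
    ext i
    fin_cases i <;> simp
  have expand : B v v = v 0 * (v 0 * hessianEntry f x 0 0 + v 1 * hessianEntry f x 0 1)
      + v 1 * (v 0 * hessianEntry f x 1 0 + v 1 * hessianEntry f x 1 1) := by
    conv_lhs => rw [hv]
    simp only [entry, map_add, map_smul, add_apply, smul_apply, smul_eq_mul]
    ring
  have coord (i : Fin 2) : |v i| ≤ ‖v‖ := PiLp.norm_apply_le v i
  have row (p q : ℝ) (hpq : |p| + |q| ≤ hessianInftyNorm f x) (i : Fin 2) :
      |v i * (v 0 * p + v 1 * q)| ≤ ‖v‖ * (‖v‖ * hessianInftyNorm f x) := by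
    rw [abs_mul]
    refine mul_le_mul (coord i) ?_ (abs_nonneg _) (norm_nonneg _)
    calc |v 0 * p + v 1 * q| ≤ |v 0| * |p| + |v 1| * |q| := by
          simpa only [abs_mul] using abs_add_le (v 0 * p) (v 1 * q)
      _ ≤ ‖v‖ * |p| + ‖v‖ * |q| := by gcongr <;> exact coord _
      _ = ‖v‖ * (|p| + |q|) := by ring
      _ ≤ _ := by gcongr
  rw [expand]
  calc _ ≤ _ := abs_add_le _ _
    _ ≤ _ := add_le_add (row _ _ (le_max_left _ _) 0) (row _ _ (le_max_right _ _) 1)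
    _ = _ := by ring

lemma continuousOn_hessianInftyNorm {f : E2 → ℝ} {U : Set E2} (hU : IsOpen U)
    (hf : ContDiffOn ℝ 2 f U) : ContinuousOn (hessianInftyNorm f) U := by
  have hcont : ContinuousOn (iteratedFDeriv ℝ 2 f) U :=
    (hf.continuousOn_iteratedFDerivWithin le_rfl hU.uniqueDiffOn).congr
      fun x hx => (iteratedFDerivWithin_of_isOpen 2 hU hx).symm
  have entry (i j : Fin 2) : ContinuousOn (fun x => hessianEntry f x i j) U :=
    (ContinuousMultilinearMap.apply ℝ (fun _ : Fin 2 => E2) ℝ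
      ![EuclideanSpace.single i 1, EuclideanSpace.single j 1]).continuous.comp_continuousOn hcont
  exact ((entry 0 0).abs.add (entry 0 1).abs).sup ((entry 1 0).abs.add (entry 1 1).abs)

/-- First-order Taylor estimate on a convex set, in terms of a bound for the second derivative
in the direction of the segment. -/
lemma abs_sub_sub_fderiv_le {E : Type*} [NormedAddCommGroup E] [NormedSpace ℝ E] {f : E → ℝ}
    {U s : Set E} (hU : IsOpen U) (hf : ContDiffOn ℝ 2 f U) (hs : Convex ℝ s) (hsU : s ⊆ U)
    {x y : E} (hx : x ∈ s) (hy : y ∈ s) {C : ℝ}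
    (hC : ∀ z ∈ s, |fderiv ℝ (fderiv ℝ f) z (y - x) (y - x)| ≤ C) :
    |f y - f x - fderiv ℝ f x (y - x)| ≤ C := by
  set v := y - x with hv
  have hC0 : 0 ≤ C := (abs_nonneg _).trans (hC x hx)
  have mem (t : ℝ) (ht : t ∈ Set.Icc (0 : ℝ) 1) : x + t • v ∈ s := hs.add_smul_sub_mem hx hy ht
  have path (t : ℝ) : HasDerivAt (fun t : ℝ => x + t • v) v t := by
    simpa using ((hasDerivAt_id t).smul_const v).const_add x
  have first (t : ℝ) (ht : t ∈ Set.Icc (0 : ℝ) 1) :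
      HasDerivAt (fun t : ℝ => f (x + t • v)) (fderiv ℝ f (x + t • v) v) t :=
    ((hf.contDiffAt (hU.mem_nhds (hsU (mem t ht)))).differentiableAt
      two_ne_zero).hasFDerivAt.comp_hasDerivAt t (path t)
  have second (t : ℝ) (ht : t ∈ Set.Icc (0 : ℝ) 1) :
      HasDerivAt (fun t : ℝ => fderiv ℝ f (x + t • v) v)
        (fderiv ℝ (fderiv ℝ f) (x + t • v) v v) t := by
    have hd : DifferentiableAt ℝ (fderiv ℝ f) (x + t • v) :=
      ((hf.contDiffAt (hU.mem_nhds (hsU (mem t ht)))).fderiv_right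
        (m := 1) (by norm_num)).differentiableAt one_ne_zero
    have hderiv : HasDerivAt (fun t : ℝ => fderiv ℝ f (x + t • v))
        (fderiv ℝ (fderiv ℝ f) (x + t • v) v) t :=
      hd.hasFDerivAt.comp_hasDerivAt t (path t)
    simpa using hderiv.clm_apply (hasDerivAt_const t v)
  have slope (t : ℝ) (ht : t ∈ Set.Icc (0 : ℝ) 1) :
      ‖fderiv ℝ f (x + t • v) v - fderiv ℝ f x v‖ ≤ C := by
    have := (convex_Icc (0 : ℝ) 1).norm_image_sub_le_of_norm_hasDerivWithin_le
      (fun u hu => (second u hu).hasDerivWithinAt) (fun u hu => hC _ (mem u hu))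
      (Set.left_mem_Icc.2 zero_le_one) ht
    simp only [zero_smul, add_zero, sub_zero, Real.norm_of_nonneg ht.1] at this
    exact this.trans (mul_le_of_le_one_right hC0 ht.2)
  have := (convex_Icc (0 : ℝ) 1).norm_image_sub_le_of_norm_hasDerivWithin_le
    (fun u hu => ((first u hu).sub
      ((hasDerivAt_id u).mul_const (fderiv ℝ f x v))).hasDerivWithinAt)
    (fun u hu => by simpa using slope u hu)
    (Set.left_mem_Icc.2 zero_le_one) (Set.right_mem_Icc.2 zero_le_one)
  simpa [hv, sub_right_comm] using this

lemma dist_le_of_mem_convexHull_triangle {E : Type*} [SeminormedAddCommGroup E] [NormedSpace ℝ E]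
    {a b c x y : E} (hx : x ∈ convexHull ℝ {a, b, c}) (hy : y ∈ convexHull ℝ {a, b, c}) :
    dist x y ≤ max (dist a b) (max (dist b c) (dist a c)) := by
  obtain ⟨p, hp, q, hq, hpq⟩ := convexHull_exists_dist_ge2 hx hy
  refine hpq.trans ?_
  rcases hp with rfl | rfl | rfl <;> rcases hq with rfl | rfl | rfl <;>
    simp [dist_comm]

/-- The h²-bound for the distance between the coefficients (control points) of a spline
and its values at the corresponding domain points, for any stable basis forming a
partition of unity which reproduces linear polynomials via its domain points. -/
theorem stmt_10 (a b c : E2) (habc : AffineIndependent ℝ ![a, b, c])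
    (h : ℝ) (hh : h = max (dist a b) (max (dist b c) (dist a c)))
    (n : ℕ) (hn : 1 ≤ n) (S : Fin n → E2 → ℝ) (ξ : Fin n → E2)
    (hξ : ∀ i, ξ i ∈ convexHull ℝ ({a, b, c} : Set E2))
    (hpart : ∀ x ∈ convexHull ℝ ({a, b, c} : Set E2), ∑ i, S i x = 1)
    (hlin : ∀ x ∈ convexHull ℝ ({a, b, c} : Set E2), ∑ i, S i x • ξ i = x)
    (K : ℝ) (hKpos : 0 < K)
    (hstab : ∀ bb : Fin n → ℝ,
      Finset.univ.sup' (Finset.univ_nonempty_iff.mpr ⟨⟨0, hn⟩⟩) (fun i => |bb i|)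
        ≤ K * sSup ((fun x => |∑ i, bb i * S i x|) '' convexHull ℝ ({a, b, c} : Set E2)))
    (U : Set E2) (hU : IsOpen U) (hΔU : convexHull ℝ ({a, b, c} : Set E2) ⊆ U)
    (f : E2 → ℝ) (hf : ContDiffOn ℝ 2 f U)
    (co : Fin n → ℝ)
    (hco : ∀ x ∈ convexHull ℝ ({a, b, c} : Set E2), f x = ∑ i, co i * S i x) :
    ∀ i, |co i - f (ξ i)| ≤
      2 * K * h ^ 2 * sSup ((fun x => hessianInftyNorm f x) '' convexHull ℝ ({a, b, c} : Set E2)) := by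
  intro i
  set Δ := convexHull ℝ ({a, b, c} : Set E2) with hΔ
  set M := sSup ((fun x => hessianInftyNorm f x) '' Δ) with hM
  have hcompact : IsCompact Δ := (Set.toFinite {a, b, c}).isCompact_convexHull ℝ
  have hbdd : BddAbove ((fun x => hessianInftyNorm f x) '' Δ) :=
    hcompact.bddAbove_image ((continuousOn_hessianInftyNorm hU hf).mono hΔU)
  have taylor (x : E2) (hx : x ∈ Δ) :
      |f x - f (ξ i) - fderiv ℝ f (ξ i) (x - ξ i)| ≤ 2 * h ^ 2 * M := by
    refine abs_sub_sub_fderiv_le hU hf (convex_convexHull ℝ _) hΔU (hξ i) hx fun z hz => ?_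
    have hzM : hessianInftyNorm f z ≤ M := le_csSup hbdd (Set.mem_image_of_mem _ hz)
    have hz0 : 0 ≤ hessianInftyNorm f z := by unfold hessianInftyNorm; positivity
    have hdist : ‖x - ξ i‖ ≤ h := by
      rw [hh, ← dist_eq_norm]
      exact dist_le_of_mem_convexHull_triangle hx (hξ i)
    refine (abs_fderiv_fderiv_apply_le f z _).trans ?_
    gcongr
  have repr (x : E2) (hx : x ∈ Δ) :
      ∑ j, (co j - (f (ξ i) + fderiv ℝ f (ξ i) (ξ j - ξ i))) * S j x =
        f x - f (ξ i) - fderiv ℝ f (ξ i) (x - ξ i) := by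
    have hL : fderiv ℝ f (ξ i) x = ∑ j, fderiv ℝ f (ξ i) (ξ j) * S j x := by
      conv_lhs => rw [← hlin x hx]
      simp [mul_comm]
    simp only [map_sub, sub_mul, add_mul, Finset.sum_sub_distrib, Finset.sum_add_distrib,
      ← Finset.mul_sum, hpart x hx, ← hco x hx, ← hL]
    ring
  have hsup : sSup ((fun x => |∑ j, (co j - (f (ξ i) + fderiv ℝ f (ξ i) (ξ j - ξ i))) * S j x|) ''
      Δ) ≤ 2 * h ^ 2 * M := by
    refine csSup_le (Set.Nonempty.image _ ⟨ξ i, hξ i⟩) ?_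
    rintro _ ⟨x, hx, rfl⟩
    simpa only [repr x hx] using taylor x hx
  calc |co i - f (ξ i)|
      = |co i - (f (ξ i) + fderiv ℝ f (ξ i) (ξ i - ξ i))| := by simp
    _ ≤ _ := Finset.le_sup'
        (fun j => |co j - (f (ξ i) + fderiv ℝ f (ξ i) (ξ j - ξ i))|) (Finset.mem_univ i)
    _ ≤ _ := hstab _
    _ ≤ K * (2 * h ^ 2 * M) := by gcongr
    _ = 2 * K * h ^ 2 * M := by ring
end
end

section
/- Let Δ ⊂ ℝ² be a nondegenerate triangle, n ≥ 1, Q_1, …, Q_n : ℝ² → ℝ functions, w_1, …, w_n ∈ ℝ, and p*_{i,1}, …, p*_{i,5} ∈ ℝ² for each i. Suppose the Marsden identity (1 + x·y)^5 = Σ_{i=1}^n w_i Q_i(x) Π_{r=1}^5 (1 + p*_{i,r}·y) holds for all x ∈ Δ and all y ∈ ℝ². For a function f : ℝ² → ℝ define L_i(f) := Σ_{k=1}^5 (k^5/5!) (−1)^{k−1} Σ_{1 ≤ r_1 < ⋯ < r_k ≤ 5} f( (p*_{i,r_1} + ⋯ + p*_{i,r_k}) / k ). Then for every bivariate polynomial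 p of total degree at most 5 and every x ∈ Δ, one has Σ_{i=1}^n L_i(p) w_i Q_i(x) = p(x). -/
open scoped RealInnerProductSpace

noncomputable section

/-- A real polynomial of degree less than `m` vanishing everywhere has zero coefficients. -/
theorem eq_zero_of_forall_sum_mul_pow_eq_zero {m : ℕ} {e : ℕ → ℝ}
    (h : ∀ t : ℝ, ∑ b ∈ Finset.range m, e b * t ^ b = 0) {b : ℕ} (hb : b < m) : e b = 0 := by
  have h0 : ∑ b ∈ Finset.range m, Polynomial.C (e b) * Polynomial.X ^ b = 0 := by
    refine Polynomial.funext fun t => ?_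
    simpa [Polynomial.eval_finsetSum] using h t
  have h1 := congrArg (fun q => Polynomial.coeff q b) h0
  simpa [Polynomial.finsetSum_coeff, Polynomial.coeff_C_mul, Polynomial.coeff_X_pow, hb] using h1

/-- Trinomial expansion of `(1 + u s + v t) ^ 5`. -/
theorem one_add_add_pow_five (u v s t : ℝ) :
    (1 + (u * s + v * t)) ^ 5 = ∑ a ∈ Finset.range 6, (∑ b ∈ Finset.range 6,
      ((Nat.choose 5 (a + b) * Nat.choose (a + b) a : ℕ) : ℝ) * (u ^ a * v ^ b) * t ^ b) *
        s ^ a := by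
  simp [Finset.sum_range_succ, Nat.choose]
  ring

theorem inner_eq_coord (x y : E2) : ⟪x, y⟫ = x 0 * y 0 + x 1 * y 1 := by
  simp [PiLp.inner_apply, Fin.sum_univ_two, mul_comm]

/-- A linear functional killing all fifth powers `(1 + ⟪·, y⟫) ^ 5` kills every monomial of
degree at most five. -/
theorem map_monomial_eq_zero (l : (E2 → ℝ) →ₗ[ℝ] ℝ)
    (hl : ∀ y : E2, l (fun x => (1 + ⟪x, y⟫) ^ 5) = 0) {a b : ℕ} (hab : a + b ≤ 5) :
    l (fun x => x 0 ^ a * x 1 ^ b) = 0 := by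
  have key : ∀ s t : ℝ, ∑ a ∈ Finset.range 6, (∑ b ∈ Finset.range 6,
      (((Nat.choose 5 (a + b) * Nat.choose (a + b) a : ℕ) : ℝ) *
        l (fun x => x 0 ^ a * x 1 ^ b)) * t ^ b) * s ^ a = 0 := by
    intro s t
    have hf : (fun x : E2 => (1 + ⟪x, !₂[s, t]⟫) ^ 5) =
        ∑ a ∈ Finset.range 6, s ^ a • ∑ b ∈ Finset.range 6,
          (t ^ b * ((Nat.choose 5 (a + b) * Nat.choose (a + b) a : ℕ) : ℝ)) •
            (fun x : E2 => x 0 ^ a * x 1 ^ b) := by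
      funext x
      have hx : ⟪x, !₂[s, t]⟫ = x 0 * s + x 1 * t := by rw [inner_eq_coord]; simp
      rw [hx, one_add_add_pow_five]
      simp only [Finset.sum_apply, Pi.smul_apply, smul_eq_mul]
      refine Finset.sum_congr rfl fun a _ => ?_
      rw [mul_comm]
      congr 1
      exact Finset.sum_congr rfl fun b _ => by ring
    have h := hl !₂[s, t]
    rw [hf] at h
    simp only [map_sum, map_smul, smul_eq_mul] at h
    rw [← h]
    refine Finset.sum_congr rfl fun a _ => ?_
    rw [mul_comm]
    congr 1
    exact Finset.sum_congr rfl fun b _ => by ring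
  have h := eq_zero_of_forall_sum_mul_pow_eq_zero (b := b)
    (fun t => eq_zero_of_forall_sum_mul_pow_eq_zero (b := a) (fun s => key s t) (by omega))
    (by omega)
  refine (mul_eq_zero.mp h).resolve_left ?_
  exact_mod_cast (Nat.mul_pos (Nat.choose_pos hab) (Nat.choose_pos (Nat.le_add_right a b))).ne'

/-- A linear functional killing all fifth powers `(1 + ⟪·, y⟫) ^ 5` kills every polynomial of
total degree at most five. -/
theorem map_eval_eq_zero (l : (E2 → ℝ) →ₗ[ℝ] ℝ)
    (hl : ∀ y : E2, l (fun x => (1 + ⟪x, y⟫) ^ 5) = 0)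
    {P : MvPolynomial (Fin 2) ℝ} (hP : P.totalDegree ≤ 5) :
    l (fun x => MvPolynomial.eval (fun j => x j) P) = 0 := by
  have hf : (fun x : E2 => MvPolynomial.eval (fun j => x j) P) =
      ∑ d ∈ P.support, P.coeff d • (fun x : E2 => x 0 ^ d 0 * x 1 ^ d 1) := by
    funext x
    simp [MvPolynomial.eval_eq', Fin.prod_univ_two]
  rw [hf, map_sum]
  refine Finset.sum_eq_zero fun d hd => ?_
  have hdeg := (MvPolynomial.le_totalDegree hd).trans hP
  rw [Finsupp.sum_fintype _ _ (fun _ => rfl), Fin.sum_univ_two] at hdeg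
  rw [map_smul, map_monomial_eq_zero l hl hdeg, smul_zero]

/-- Polarization: a product of five reals in terms of fifth powers of partial sums. -/
theorem polarization_five (a : Fin 5 → ℝ) :
    ∑ k ∈ Finset.Icc (1 : ℕ) 5, (-1 : ℝ) ^ (k - 1) *
      ∑ s ∈ Finset.powersetCard k (Finset.univ : Finset (Fin 5)), (∑ r ∈ s, a r) ^ 5 =
    120 * ∏ r, a r := by
  have h1 : Finset.powersetCard 1 (Finset.univ : Finset (Fin 5)) = {{0}, {1}, {2}, {3}, {4}} := by
    decide
  have h2 : Finset.powersetCard 2 (Finset.univ : Finset (Fin 5)) =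
      {{0, 1}, {0, 2}, {0, 3}, {0, 4}, {1, 2}, {1, 3}, {1, 4}, {2, 3}, {2, 4}, {3, 4}} := by
    decide
  have h3 : Finset.powersetCard 3 (Finset.univ : Finset (Fin 5)) =
      {{0, 1, 2}, {0, 1, 3}, {0, 1, 4}, {0, 2, 3}, {0, 2, 4}, {0, 3, 4}, {1, 2, 3}, {1, 2, 4},
        {1, 3, 4}, {2, 3, 4}} := by
    decide
  have h4 : Finset.powersetCard 4 (Finset.univ : Finset (Fin 5)) =
      {{0, 1, 2, 3}, {0, 1, 2, 4}, {0, 1, 3, 4}, {0, 2, 3, 4}, {1, 2, 3, 4}} := by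
    decide
  have h5 : Finset.powersetCard 5 (Finset.univ : Finset (Fin 5)) = {{0, 1, 2, 3, 4}} := by
    decide
  have hI : Finset.Icc (1 : ℕ) 5 = {1, 2, 3, 4, 5} := by decide
  rw [hI]
  repeat rw [Finset.sum_insert (by decide)]
  rw [Finset.sum_singleton, h1, h2, h3, h4, h5]
  repeat rw [Finset.sum_insert (by decide)]
  simp only [Finset.sum_singleton]
  repeat rw [Finset.sum_insert (by decide)]
  simp only [Finset.sum_singleton, Fin.prod_univ_five]
  ring

/-- The quasi-interpolation coefficient functional with dual points `q`. -/
def coeffFunctional (q : Fin 5 → E2) : (E2 → ℝ) →ₗ[ℝ] ℝ :=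
  ∑ k ∈ Finset.Icc (1 : ℕ) 5, (((k : ℝ) ^ 5 / 120) * (-1 : ℝ) ^ (k - 1)) •
    ∑ s ∈ Finset.powersetCard k (Finset.univ : Finset (Fin 5)),
      LinearMap.proj ((k : ℝ)⁻¹ • ∑ r ∈ s, q r)

theorem coeffFunctional_apply (q : Fin 5 → E2) (f : E2 → ℝ) :
    coeffFunctional q f = ∑ k ∈ Finset.Icc (1 : ℕ) 5, ((k : ℝ) ^ 5 / 120) * (-1 : ℝ) ^ (k - 1) *
      ∑ s ∈ Finset.powersetCard k (Finset.univ : Finset (Fin 5)),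
        f ((k : ℝ)⁻¹ • ∑ r ∈ s, q r) := by
  simp [coeffFunctional, LinearMap.sum_apply]

theorem coeffFunctional_pow_five (q : Fin 5 → E2) (y : E2) :
    coeffFunctional q (fun x => (1 + ⟪x, y⟫) ^ 5) = ∏ r, (1 + ⟪q r, y⟫) := by
  rw [coeffFunctional_apply, ← mul_right_inj' (show (120 : ℝ) ≠ 0 by norm_num),
    ← polarization_five, Finset.mul_sum]
  refine Finset.sum_congr rfl fun k hk => ?_
  have hk0 : (k : ℝ) ≠ 0 := by
    have := (Finset.mem_Icc.mp hk).1
    exact_mod_cast (by omega : k ≠ 0)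
  simp only [Finset.mul_sum]
  refine Finset.sum_congr rfl fun s hs => ?_
  have hsum : ∑ r ∈ s, (1 + ⟪q r, y⟫) = k * (1 + ⟪(k : ℝ)⁻¹ • ∑ r ∈ s, q r, y⟫) := by
    rw [Finset.sum_add_distrib, real_inner_smul_left, sum_inner, Finset.sum_const,
      (Finset.mem_powersetCard.mp hs).2, nsmul_eq_mul]
    field_simp
  rw [hsum]
  ring

/-- The quasi-interpolant built from a family satisfying a quintic Marsden identity
reproduces all polynomials of total degree at most 5: for every such polynomial `P`
and every `x` in the triangle, `Σᵢ Lᵢ(P) wᵢ Qᵢ(x) = P(x)`, where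
`Lᵢ(f) = Σ_{k=1}^5 (k⁵/5!) (−1)^{k−1} Σ_{|s|=k} f((Σ_{r∈s} p i r)/k)`. -/
theorem stmt_13 (v1 v2 v3 : E2) (hΔ : AffineIndependent ℝ ![v1, v2, v3])
    (n : ℕ) (hn : 1 ≤ n) (Q : Fin n → E2 → ℝ) (w : Fin n → ℝ) (p : Fin n → Fin 5 → E2)
    (hM : ∀ x ∈ convexHull ℝ ({v1, v2, v3} : Set E2), ∀ y : E2,
      (1 + ⟪x, y⟫) ^ 5 = ∑ i, w i * Q i x * ∏ r, (1 + ⟪p i r, y⟫))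
    (P : MvPolynomial (Fin 2) ℝ) (hP : P.totalDegree ≤ 5) :
    ∀ x ∈ convexHull ℝ ({v1, v2, v3} : Set E2),
      ∑ i, (∑ k ∈ Finset.Icc (1 : ℕ) 5, ((k : ℝ) ^ 5 / 120) * (-1 : ℝ) ^ (k - 1) *
            ∑ s ∈ Finset.powersetCard k (Finset.univ : Finset (Fin 5)),
              MvPolynomial.eval (fun j => (((k : ℝ)⁻¹ • ∑ r ∈ s, p i r : E2)) j) P)
          * (w i * Q i x)
        = MvPolynomial.eval (fun j => x j) P := by
  intro x hx
  have h := map_eval_eq_zero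
    (∑ i, (w i * Q i x) • coeffFunctional (p i) - LinearMap.proj x) (fun y => by
      simp only [LinearMap.sub_apply, LinearMap.sum_apply, LinearMap.smul_apply,
        coeffFunctional_pow_five, LinearMap.proj_apply, smul_eq_mul]
      rw [hM x hx y, sub_self]) hP
  simp only [LinearMap.sub_apply, LinearMap.sum_apply, LinearMap.smul_apply,
    coeffFunctional_apply, LinearMap.proj_apply, smul_eq_mul] at h
  rw [← sub_eq_zero.mp h]
  exact Finset.sum_congr rfl fun i _ => mul_comm _ _
end
end
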